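/- arXiv:1702.01913 — 2 statements merged into one kernel-verified Lean document; each statement's English description precedes it below -/
import Mathlib

section
/- Let X be a torsion-free discrete Abelian group and let α be an automorphism of X satisfying Ker(I + α) = {0}, where I is the identity automorphism. Let ξ₁, ξ₂ be independent X-valued random variables with distributions μ₁, μ₂. If the conditional distribution of the linear form L₂ = ξ₁ + αξ₂ given L₁ = ξ₁ + ξ₂ is symmetric, then μ₁ and μ₂ are degenerate distributions (point masses). -/
open MeasureTheory ProbabilityTheory

open scoped Pointwise in
/-- In a torsion-free Abelian group, two distinct translates of a nonempty finite set cannot both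
lie in a set of the same cardinality. -/
lemma eq_of_pair_add_subset {X : Type*} [AddCommGroup X] [IsAddTorsionFree X] [DecidableEq X]
    {S T : Finset X} (hS : S.Nonempty) (hcard : T.card ≤ S.card) {b b' : X}
    (hb : ∀ s ∈ S, b + s ∈ T) (hb' : ∀ s ∈ S, b' + s ∈ T) : b = b' := by
  by_contra hne
  have hCD : ({b, b'} : Finset X).card + S.card - 1 ≤ (({b, b'} : Finset X) + S).card :=
    cauchy_davenport_of_isAddTorsionFree (Finset.insert_nonempty _ _) hS
  have hsub : ({b, b'} : Finset X) + S ⊆ T := by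
    intro z hz
    obtain ⟨u, hu, s, hs, rfl⟩ := Finset.mem_add.1 hz
    rcases Finset.mem_insert.1 hu with rfl | hu
    · exact hb s hs
    · rw [Finset.mem_singleton.1 hu]
      exact hb' s hs
  have hle := Finset.card_le_card hsub
  rw [Finset.card_pair hne] at hCD
  have := hS.card_pos
  omega

section

variable {X Ω : Type*} [Countable X] [MeasurableSpace X] [MeasurableSingletonClass X]
  [MeasurableSpace Ω] {P : Measure Ω}

lemma measure_eq_tsum_inter_fiber {ξ : Ω → X} (hm : Measurable ξ) {E : Set Ω}
    (hE : MeasurableSet E) : P E = ∑' x, P (E ∩ ξ ⁻¹' {x}) := by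
  rw [← measure_iUnion]
  · rw [← Set.inter_iUnion, ← Set.preimage_iUnion, Set.iUnion_of_singleton, Set.preimage_univ,
      Set.inter_univ]
  · intro x y hxy
    refine Set.disjoint_left.2 fun ω h h' => hxy ?_
    exact h.2.symm.trans h'.2
  · exact fun x => hE.inter (hm (measurableSet_singleton x))

lemma tsum_measure_fiber [IsProbabilityMeasure P] {ξ : Ω → X} (hm : Measurable ξ) :
    ∑' x, P (ξ ⁻¹' {x}) = 1 := by
  have := measure_eq_tsum_inter_fiber (P := P) hm MeasurableSet.univ
  simpa using this.symm

lemma exists_ne_zero_measure_fiber [IsProbabilityMeasure P] {ξ : Ω → X} (hm : Measurable ξ) :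
    ∃ x, P (ξ ⁻¹' {x}) ≠ 0 := by
  by_contra! h
  have := tsum_measure_fiber (P := P) hm
  simp [h] at this

lemma finite_le_measure_fiber [IsProbabilityMeasure P] {ξ : Ω → X} (hm : Measurable ξ)
    {c : ENNReal} (hc : c ≠ 0) : {x | c ≤ P (ξ ⁻¹' {x})}.Finite :=
  ENNReal.finite_const_le_of_tsum_ne_top
    (by rw [tsum_measure_fiber hm]; exact ENNReal.one_ne_top) hc

lemma exists_forall_measure_fiber_le [IsProbabilityMeasure P] {ξ : Ω → X} (hm : Measurable ξ) :
    ∃ x, P (ξ ⁻¹' {x}) ≠ 0 ∧ ∀ y, P (ξ ⁻¹' {y}) ≤ P (ξ ⁻¹' {x}) := by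
  obtain ⟨x₀, hx₀⟩ := exists_ne_zero_measure_fiber (P := P) hm
  obtain ⟨x, hx, hmax⟩ := Set.exists_max_image _ (fun x => P (ξ ⁻¹' {x}))
    (finite_le_measure_fiber (P := P) hm hx₀) ⟨x₀, le_refl (P (ξ ⁻¹' {x₀}))⟩
  refine ⟨x, fun h => hx₀ (le_antisymm (h ▸ hx) zero_le), fun y => ?_⟩
  rcases le_total (P (ξ ⁻¹' {x₀})) (P (ξ ⁻¹' {y})) with h | h
  · exact hmax y h
  · exact h.trans hx

end

/-- If the law of `ξ₂ - α ξ₂` agrees with the law of `2 ξ₁ + (ξ₂ + α ξ₂)`, then at most one value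
of `ξ₁` has positive probability. -/
lemma eq_of_measure_fiber_ne_zero {X : Type*} [AddCommGroup X] [IsAddTorsionFree X] [Countable X]
    [MeasurableSpace X] [DiscreteMeasurableSpace X]
    (α : X ≃+ X) (hker : ∀ x : X, x + α x = 0 → x = 0)
    {Ω : Type*} [MeasurableSpace Ω] {P : Measure Ω} [IsProbabilityMeasure P]
    {ξ₁ ξ₂ : Ω → X} (hm₁ : Measurable ξ₁) (hm₂ : Measurable ξ₂) (hindep : IndepFun ξ₁ ξ₂ P)
    (hlaw : ∀ c, P {ω | ξ₂ ω - α (ξ₂ ω) = c} = P {ω | 2 • ξ₁ ω + (ξ₂ ω + α (ξ₂ ω)) = c})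
    {a a' : X} (ha : P (ξ₁ ⁻¹' {a}) ≠ 0) (ha' : P (ξ₁ ⁻¹' {a'}) ≠ 0) : a = a' := by
  classical
  have hinj : ∀ x y : X, x + α x = y + α y → x = y := fun x y h =>
    sub_eq_zero.1 <| hker _ <| by
      rw [map_sub, sub_add_sub_comm, h, sub_self]
  obtain ⟨y₀, hy₀, hmax⟩ := exists_forall_measure_fiber_le (P := P) hm₂
  set M := P (ξ₂ ⁻¹' {y₀}) with hM
  have hMtop : M ≠ ⊤ := measure_ne_top _ _
  have hfin : {y | M ≤ P (ξ₂ ⁻¹' {y})}.Finite := finite_le_measure_fiber hm₂ hy₀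
  set B := hfin.toFinset with hB
  have hfiber : ∀ z, {ω | ξ₂ ω + α (ξ₂ ω) = z + α z} = ξ₂ ⁻¹' {z} := fun z =>
    Set.ext fun ω => ⟨fun h => hinj _ _ h, fun h => by
      rw [Set.mem_preimage, Set.mem_singleton_iff] at h
      rw [Set.mem_ofPred_eq, h]⟩
  have hle : ∀ d, P {ω | ξ₂ ω + α (ξ₂ ω) = d} ≤ M := by
    intro d
    by_cases hd : ∃ z : X, z + α z = d
    · obtain ⟨z, rfl⟩ := hd
      rw [hfiber]
      exact hmax z
    · have : {ω | ξ₂ ω + α (ξ₂ ω) = d} = ∅ :=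
        Set.eq_empty_of_forall_notMem fun ω h => hd ⟨_, h⟩
      simp [this]
  have hsum : ∀ c, P {ω | 2 • ξ₁ ω + (ξ₂ ω + α (ξ₂ ω)) = c} =
      ∑' x, P (ξ₁ ⁻¹' {x}) * P {ω | ξ₂ ω + α (ξ₂ ω) = c - 2 • x} := by
    intro c
    rw [measure_eq_tsum_inter_fiber hm₁]
    · refine tsum_congr fun x => ?_
      have hset : {ω | 2 • ξ₁ ω + (ξ₂ ω + α (ξ₂ ω)) = c} ∩ ξ₁ ⁻¹' {x} =
          ξ₁ ⁻¹' {x} ∩ ξ₂ ⁻¹' {y | y + α y = c - 2 • x} := by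
        ext ω
        simp only [Set.mem_inter_iff, Set.mem_ofPred_eq, Set.mem_preimage, Set.mem_singleton_iff]
        constructor
        · rintro ⟨h, rfl⟩
          exact ⟨rfl, by rw [← h]; abel⟩
        · rintro ⟨rfl, h⟩
          exact ⟨by rw [h]; abel, rfl⟩
      rw [hset, hindep.measure_inter_preimage_eq_mul _ _ (.of_discrete) (.of_discrete)]
      rfl
    · exact (((Measurable.of_discrete (f := fun p : X × X => 2 • p.1 + (p.2 + α p.2))).comp
        (hm₁.prodMk hm₂)) (MeasurableSet.singleton c))
  have hsumM : ∑' x, P (ξ₁ ⁻¹' {x}) * M = M := by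
    rw [ENNReal.tsum_mul_right, tsum_measure_fiber hm₁, one_mul]
  have hdiff_le : ∀ c, P {ω | ξ₂ ω - α (ξ₂ ω) = c} ≤ M := by
    intro c
    rw [hlaw, hsum, ← hsumM]
    exact ENNReal.tsum_le_tsum fun x => mul_le_mul_right (hle _) _
  have hinjOn : Set.InjOn (fun y => y - α y) (B : Set X) := by
    intro y hy y' hy' h
    by_contra hne
    have hMy : M ≤ P (ξ₂ ⁻¹' {y}) := by simpa [hB] using hy
    have hMy' : M ≤ P (ξ₂ ⁻¹' {y'}) := by simpa [hB] using hy'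
    have hsub : ξ₂ ⁻¹' {y} ∪ ξ₂ ⁻¹' {y'} ⊆ {ω | ξ₂ ω - α (ξ₂ ω) = y - α y} := by
      rintro ω (hω | hω) <;> rw [Set.mem_preimage, Set.mem_singleton_iff] at hω <;>
        rw [Set.mem_ofPred_eq, hω]
      exact h.symm
    have hdisj : Disjoint (ξ₂ ⁻¹' {y}) (ξ₂ ⁻¹' {y'}) :=
      Set.disjoint_left.2 fun ω h h' => hne (h.symm.trans h')
    have hMM : M + M ≤ M := calc
      M + M ≤ P (ξ₂ ⁻¹' {y}) + P (ξ₂ ⁻¹' {y'}) := add_le_add hMy hMy'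
      _ = P (ξ₂ ⁻¹' {y} ∪ ξ₂ ⁻¹' {y'}) :=
        (measure_union hdisj (hm₂ (measurableSet_singleton _))).symm
      _ ≤ _ := measure_mono hsub
      _ ≤ M := hdiff_le _
    exact absurd hMM (not_le.2 (ENNReal.lt_add_right hMtop hy₀))
  have key : ∀ x, P (ξ₁ ⁻¹' {x}) ≠ 0 → ∀ s ∈ B.image (fun y => y - α y),
      -(2 • x) + s ∈ B.image (fun y => y + α y) := by
    intro x hx s hs
    obtain ⟨y, hy, rfl⟩ := Finset.mem_image.1 hs
    have hMy : M ≤ P (ξ₂ ⁻¹' {y}) := by simpa [hB] using hy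
    have hge : M ≤ P {ω | ξ₂ ω + α (ξ₂ ω) = y - α y - 2 • x} := by
      by_contra! hlt
      have hMle : M ≤ P {ω | ξ₂ ω - α (ξ₂ ω) = y - α y} := hMy.trans <| measure_mono fun ω hω => by
        rw [Set.mem_preimage, Set.mem_singleton_iff] at hω
        rw [Set.mem_ofPred_eq, hω]
      rw [hlaw, hsum] at hMle
      refine absurd hMle (not_le.2 ?_)
      conv_rhs => rw [← hsumM]
      refine ENNReal.tsum_lt_tsum (i := x) (ne_top_of_le_ne_top hMtop ?_) (fun z => ?_) ?_
      · rw [← hsum, ← hlaw]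
        exact hdiff_le _
      · exact mul_le_mul_right (hle _) _
      · exact (ENNReal.mul_lt_mul_iff_right hx (measure_ne_top _ _)).2 hlt
    obtain ⟨ω, hω⟩ := nonempty_of_measure_ne_zero
      (ne_of_gt ((pos_iff_ne_zero.2 hy₀).trans_le hge))
    rw [Set.mem_ofPred_eq] at hω
    rw [← hω, hfiber] at hge
    exact Finset.mem_image.2 ⟨ξ₂ ω, by simpa [hB] using hge, by rw [hω]; abel⟩
  have hBne : B.Nonempty := ⟨y₀, by simp [hB, hM]⟩
  have h := eq_of_pair_add_subset (hBne.image _)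
    (by rw [Finset.card_image_of_injOn hinjOn]; exact Finset.card_image_le) (key a ha) (key a' ha')
  exact nsmul_right_injective two_ne_zero (neg_injective h)

/-- Lemma 4: let `X` be a (countable) torsion-free discrete Abelian group and `α` an
automorphism of `X` with `Ker(I + α) = {0}`. If the conditional distribution of
`L₂ = ξ₁ + α ξ₂` given `L₁ = ξ₁ + ξ₂` is symmetric, then `μ₁` and `μ₂` are degenerate. -/
theorem heyde_lemma4 {X : Type*} [AddCommGroup X] [Countable X]
    [TopologicalSpace X] [DiscreteTopology X] [MeasurableSpace X] [BorelSpace X]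
    (htorsionfree : ∀ (x : X) (n : ℕ), n ≠ 0 → n • x = 0 → x = 0)
    (α : X ≃+ X) (hker : ∀ x : X, x + α x = 0 → x = 0)
    {Ω : Type*} [MeasurableSpace Ω] (P : Measure Ω) [IsProbabilityMeasure P]
    (ξ₁ ξ₂ : Ω → X) (hm₁ : Measurable ξ₁) (hm₂ : Measurable ξ₂)
    (hindep : IndepFun ξ₁ ξ₂ P)
    (hsym : P.map (fun ω => (ξ₁ ω + ξ₂ ω, ξ₁ ω + α (ξ₂ ω))) =
      P.map (fun ω => (ξ₁ ω + ξ₂ ω, -(ξ₁ ω + α (ξ₂ ω))))) :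
    (∃ x₁ : X, P.map ξ₁ = Measure.dirac x₁) ∧ (∃ x₂ : X, P.map ξ₂ = Measure.dirac x₂) := by
  have : DiscreteMeasurableSpace X := ⟨fun s => (isOpen_discrete s).measurableSet⟩
  have : IsAddTorsionFree X := ⟨fun n hn x y hxy => sub_eq_zero.1 <| htorsionfree _ n hn <| by
    rw [nsmul_sub, sub_eq_zero]
    exact hxy⟩
  have hmL : Measurable fun ω => (ξ₁ ω + ξ₂ ω, ξ₁ ω + α (ξ₂ ω)) :=
    (Measurable.of_discrete (f := fun p : X × X => (p.1 + p.2, p.1 + α p.2))).comp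
      (hm₁.prodMk hm₂)
  have hmL' : Measurable fun ω => (ξ₁ ω + ξ₂ ω, -(ξ₁ ω + α (ξ₂ ω))) :=
    (Measurable.of_discrete (f := fun p : X × X => (p.1, -p.2))).comp hmL
  have hlaw : ∀ c, P {ω | ξ₂ ω - α (ξ₂ ω) = c} =
      P {ω | 2 • ξ₁ ω + (ξ₂ ω + α (ξ₂ ω)) = c} := by
    intro c
    have h := congrArg (fun μ => μ {p : X × X | p.1 - p.2 = c}) hsym
    simp only [Measure.map_apply hmL (.of_discrete), Measure.map_apply hmL' (.of_discrete),
      Set.preimage_ofPred_eq] at h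
    convert h using 5
    · abel
    · abel
  obtain ⟨a, ha⟩ := exists_ne_zero_measure_fiber (P := P) hm₁
  have hξ₁ : ∀ᵐ ω ∂P, ξ₁ ω = a := by
    have h : ∀ᵐ ω ∂P, ∀ x, x ≠ a → ξ₁ ω ≠ x := by
      refine ae_all_iff.2 fun x => ?_
      by_cases hx : x = a
      · simp [hx]
      · have h0 : P (ξ₁ ⁻¹' {x}) = 0 := by
          by_contra hne
          exact hx (eq_of_measure_fiber_ne_zero α hker hm₁ hm₂ hindep hlaw hne ha)
        filter_upwards [measure_eq_zero_iff_ae_notMem.1 h0] with ω hω _ using hω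
    filter_upwards [h] with ω hω
    by_contra hne
    exact hω _ hne rfl
  have hξ₂ : ∀ᵐ ω ∂P, ξ₂ ω = α.symm (-a) := by
    have h : ∀ᵐ p ∂P.map (fun ω => (ξ₁ ω + ξ₂ ω, ξ₁ ω + α (ξ₂ ω))), p.2 = a + α (p.1 - a) := by
      rw [ae_map_iff hmL.aemeasurable .of_discrete]
      filter_upwards [hξ₁] with ω hω
      simp [hω]
    rw [hsym, ae_map_iff hmL'.aemeasurable .of_discrete] at h
    filter_upwards [hξ₁, h] with ω hω hω'
    simp only [hω, add_sub_cancel_left] at hω'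
    have h0 : a + α (ξ₂ ω) = 0 := htorsionfree _ 2 two_ne_zero <| by
      rw [two_nsmul]
      nth_rewrite 1 [← hω']
      exact neg_add_cancel _
    rw [AddEquiv.eq_symm_apply]
    exact (neg_eq_of_add_eq_zero_right h0).symm
  exact ⟨⟨a, by rw [Measure.map_congr hξ₁, Measure.map_const, measure_univ, one_smul]⟩,
    ⟨α.symm (-a), by rw [Measure.map_congr hξ₂, Measure.map_const, measure_univ, one_smul]⟩⟩
end

section
/- Let X = ℝⁿ × F, where n ≥ 0 and F is a finite Abelian group, and let α₁, α₂, β₁, β₂ be topological automorphisms of X. Let ξ₁, ξ₂ be independent X-valued random variables with distributions μ₁, μ₂. If the linear forms L₁ = α₁ξ₁ + α₂ξ₂ and L₂ = β₁ξ₁ + β₂ξ₂ are independent, then each μ_j is a convolution of a Gaussian distribution and an idempotent distribution, i.e., μ_j ∈ Γ(X)*I(X) for j = 1, 2. -/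
open MeasureTheory ProbabilityTheory

/-- The character group (Pontryagin dual) `Y` of an additive topological Abelian group `X`. -/
abbrev Dual (X : Type*) [AddCommGroup X] [TopologicalSpace X] : Type _ :=
  PontryaginDual (Multiplicative X)

/-- The characteristic function `μ̂(y) = ∫_X (x,y) dμ(x)` of a distribution `μ` on `X`. -/
noncomputable def charFun {X : Type*} [AddCommGroup X] [TopologicalSpace X] [MeasurableSpace X]
    (μ : Measure X) (y : Dual X) : ℂ :=
  ∫ x, (y (Multiplicative.ofAdd x) : ℂ) ∂μ

/-- A distribution `γ` on `X` is Gaussian if `γ̂(y) = (x,y) exp{−φ(y)}` for some `x ∈ X` and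
some continuous non-negative function `φ` on `Y` satisfying
`φ(u+v) + φ(u−v) = 2[φ(u) + φ(v)]`. -/
def IsGaussian {X : Type*} [AddCommGroup X] [TopologicalSpace X] [MeasurableSpace X]
    (μ : Measure X) : Prop :=
  ∃ (x : X) (φ : Dual X → ℝ), Continuous φ ∧ (∀ y, 0 ≤ φ y) ∧
    (∀ u v : Dual X, φ (u * v) + φ (u * v⁻¹) = 2 * (φ u + φ v)) ∧
    ∀ y : Dual X, charFun μ y = (y (Multiplicative.ofAdd x) : ℂ) * Complex.exp (-(φ y : ℂ))

/-- A distribution on `X` is idempotent if it is a shift `m_K * E_x` of the Haar distribution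
`m_K` of a compact subgroup `K` of `X`. -/
def IsIdempotentDist {X : Type*} [AddCommGroup X] [TopologicalSpace X] [MeasurableSpace X]
    (μ : Measure X) : Prop :=
  ∃ (K : AddSubgroup X) (m : Measure X) (x : X),
    IsCompact (K : Set X) ∧ IsProbabilityMeasure m ∧ m (K : Set X) = 1 ∧
    (∀ k ∈ K, Measure.map (fun z => k + z) m = m) ∧
    μ = Measure.map (fun z => x + z) m

/-- Properties of characteristic functions used in the algebraic part of the argument. -/
structure IsCharLike {Y : Type*} [AddCommGroup Y] (f : Y → ℂ) : Prop where
  map_zero : f 0 = 1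
  norm_le (u : Y) : ‖f u‖ ≤ 1
  map_neg (u : Y) : f (-u) = (starRingEnd ℂ) (f u)
  map_add (v : Y) (hv : ‖f v‖ = 1) (u : Y) : f (u + v) = f u * f v

/-- The functional equation expressing independence of `ξ + η` and `ξ + δη`, where `f`, `g` are
the characteristic functions of `ξ`, `η` and `ε` is the adjoint of `δ`. -/
structure IsSkitovichPair {Y : Type*} [AddCommGroup Y] (ε : Y → Y) (f g : Y → ℂ) : Prop where
  left : IsCharLike f
  right : IsCharLike g
  eqn (u v : Y) : f (u + v) * g (u + ε v) = f u * f v * g u * g (ε v)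

namespace IsCharLike

variable {Y : Type*} [AddCommGroup Y] {f : Y → ℂ}

lemma norm_neg (hf : IsCharLike f) (u : Y) : ‖f (-u)‖ = ‖f u‖ := by
  rw [hf.map_neg, RCLike.norm_conj]

lemma norm_add (hf : IsCharLike f) {v : Y} (hv : ‖f v‖ = 1) (u : Y) : ‖f (u + v)‖ = ‖f u‖ := by
  rw [hf.map_add v hv, norm_mul, hv, mul_one]

lemma norm_sub_eq_one (hf : IsCharLike f) {u v : Y} (hu : ‖f u‖ = 1) (hv : ‖f v‖ = 1) :
    ‖f (u - v)‖ = 1 := by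
  rw [sub_eq_add_neg, hf.norm_add (by rw [hf.norm_neg, hv]), hu]

lemma comp (hf : IsCharLike f) {Z : Type*} [AddCommGroup Z] (φ : Z →+ Y) :
    IsCharLike (f ∘ φ) where
  map_zero := by simp [hf.map_zero]
  norm_le u := hf.norm_le _
  map_neg u := by simp [hf.map_neg]
  map_add v hv u := by simpa using hf.map_add (φ v) hv (φ u)

end IsCharLike

lemma eq_one_of_mul_eq_one {a b : ℝ} (ha : 0 ≤ a) (ha' : a ≤ 1) (hb : b ≤ 1)
    (h : a * b = 1) : a = 1 ∧ b = 1 := by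
  have h1 : a = 1 := by nlinarith
  subst h1
  exact ⟨rfl, by linarith⟩

namespace IsSkitovichPair

variable {Y : Type*} [AddCommGroup Y] {f g : Y → ℂ}

lemma comp {ε : Y → Y} (h : IsSkitovichPair ε f g) {Z : Type*} [AddCommGroup Z] (φ : Z →+ Y)
    {ε' : Z → Z} (hε : ∀ z, φ (ε' z) = ε (φ z)) : IsSkitovichPair ε' (f ∘ φ) (g ∘ φ) where
  left := h.left.comp φ
  right := h.right.comp φ
  eqn u v := by simpa [hε] using h.eqn (φ u) (φ v)

variable {ε : Y →+ Y}

lemma norm_left_sub (h : IsSkitovichPair ε f g) (v : Y) :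
    ‖f (v - ε v)‖ = ‖f v‖ * (‖f (ε v)‖ * ‖g (ε v)‖ ^ 2) := by
  have := congrArg norm (h.eqn (-ε v) v)
  simp only [norm_mul, h.left.norm_neg, h.right.norm_neg, neg_add_cancel, h.right.map_zero,
    mul_one] at this
  rw [show v - ε v = -ε v + v by abel, this]
  ring

lemma norm_right_sub (h : IsSkitovichPair ε f g) (v : Y) :
    ‖g (v - ε v)‖ = ‖g v‖ * (‖g (ε v)‖ * ‖f v‖ ^ 2) := by
  have := congrArg norm (h.eqn v (-v))
  simp only [norm_mul, h.left.norm_neg, h.right.norm_neg, add_neg_cancel, h.left.map_zero,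
    one_mul, _root_.map_neg] at this
  rw [sub_eq_add_neg, this]
  ring

lemma norm_left_sub_le (h : IsSkitovichPair ε f g) (v : Y) : ‖f (v - ε v)‖ ≤ ‖f v‖ := by
  rw [h.norm_left_sub]
  exact mul_le_of_le_one_right (norm_nonneg _) (mul_le_one₀ (h.left.norm_le _) (by positivity)
    (pow_le_one₀ (norm_nonneg _) (h.right.norm_le _)))

lemma norm_right_sub_le (h : IsSkitovichPair ε f g) (v : Y) : ‖g (v - ε v)‖ ≤ ‖g v‖ := by
  rw [h.norm_right_sub]
  exact mul_le_of_le_one_right (norm_nonneg _) (mul_le_one₀ (h.right.norm_le _) (by positivity)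
    (pow_le_one₀ (norm_nonneg _) (h.left.norm_le _)))

/-- Both functions have modulus one on the nilpotent part of `1 - ε`. -/
lemma norm_eq_one_of_iterate (h : IsSkitovichPair ε f g) (k : ℕ) (v : Y)
    (hv : (fun x => x - ε x)^[k] v = 0) : ‖f v‖ = 1 ∧ ‖g v‖ = 1 := by
  induction k generalizing v with
  | zero =>
    have : v = 0 := hv
    simp [this, h.left.map_zero, h.right.map_zero]
  | succ k ih =>
    obtain ⟨h1, h2⟩ := ih _ hv
    exact ⟨le_antisymm (h.left.norm_le _) (h1 ▸ h.norm_left_sub_le v),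
      le_antisymm (h.right.norm_le _) (h2 ▸ h.norm_right_sub_le v)⟩

lemma norm_left_iterate_le (h : IsSkitovichPair ε f g) (k : ℕ) (v : Y) :
    ‖f ((fun x => x - ε x)^[k] v)‖ ≤ ‖f v‖ := by
  induction k generalizing v with
  | zero => exact le_rfl
  | succ k ih => exact (ih _).trans (h.norm_left_sub_le v)

lemma iterate_sub_sub (ε : Y →+ Y) (k : ℕ) (u v : Y) :
    (fun x => x - ε x)^[k] (u - v) = (fun x => x - ε x)^[k] u - (fun x => x - ε x)^[k] v :=
  iterate_map_sub (AddMonoidHom.id Y - ε) k u v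

lemma iterate_sub_comm (ε : Y →+ Y) (k : ℕ) (v : Y) :
    (fun x => x - ε x)^[k] (ε v) = ε ((fun x => x - ε x)^[k] v) := by
  refine (Function.Commute.iterate_right (f := ε) ?_ k v).symm
  intro x
  simp

/-- On a finite group some positive iterate is idempotent. -/
lemma exists_iterate_idempotent {H : Type*} [Finite H] (T : H → H) (N : ℕ) :
    ∃ q, 0 < q ∧ N ≤ q ∧ ∀ v, T^[q + q] v = T^[q] v := by
  obtain ⟨i, j, hne, hij⟩ := Finite.exists_ne_map_eq_of_infinite (fun k : ℕ => T^[k])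
  wlog hlt : i < j generalizing i j
  · exact this j i hne.symm hij.symm (by omega)
  obtain ⟨p, rfl⟩ := Nat.exists_eq_add_of_lt hlt
  have hper : ∀ k m, i ≤ k → T^[k + m * (p + 1)] = T^[k] := by
    intro k m hk
    induction m with
    | zero => simp
    | succ m ih =>
      obtain ⟨c, rfl⟩ := Nat.exists_eq_add_of_le' hk
      rw [show c + i + (m + 1) * (p + 1) = (c + m * (p + 1)) + (i + p + 1) by ring,
        Function.iterate_add, ← show T^[i] = T^[i + p + 1] from hij, ← Function.iterate_add,
        show c + m * (p + 1) + i = c + i + m * (p + 1) by ring, ih]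
  refine ⟨(i + N + 1) * (p + 1), by positivity, by nlinarith, fun v => ?_⟩
  rw [hper _ _ (by nlinarith)]

lemma norm_add_of_iterate (h : IsSkitovichPair ε f g) {k : ℕ} {n : Y}
    (hn : (fun x => x - ε x)^[k] n = 0) (v : Y) :
    ‖f (v + n)‖ = ‖f v‖ ∧ ‖g (v + n)‖ = ‖g v‖ :=
  ⟨h.left.norm_add (h.norm_eq_one_of_iterate k n hn).1 v,
    h.right.norm_add (h.norm_eq_one_of_iterate k n hn).2 v⟩

lemma norm_iterate_idempotent (h : IsSkitovichPair ε f g) {q : ℕ}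
    (hq : ∀ v, (fun x => x - ε x)^[q + q] v = (fun x => x - ε x)^[q] v) (v : Y) :
    ‖f ((fun x => x - ε x)^[q] v)‖ = ‖f v‖ ∧ ‖g ((fun x => x - ε x)^[q] v)‖ = ‖g v‖ := by
  have hn : (fun x => x - ε x)^[q] (v - (fun x => x - ε x)^[q] v) = 0 := by
    rw [iterate_sub_sub, ← Function.iterate_add_apply, hq, sub_self]
  have := h.norm_add_of_iterate hn ((fun x => x - ε x)^[q] v)
  rw [add_sub_cancel] at this
  exact ⟨this.1.symm, this.2.symm⟩

/-- On a finite group both functions have modulus `0` or `1`, with the same support. -/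
lemma norm_eq_one_of_finite [Finite Y] (hε : Function.Injective ε) (h : IsSkitovichPair ε f g) :
    (∀ v, f v ≠ 0 → ‖f v‖ = 1 ∧ ‖g v‖ = 1) ∧ ∀ v, ‖f (ε v)‖ = 1 → ‖f v‖ = 1 := by
  obtain ⟨q, hq0, -, hq⟩ := exists_iterate_idempotent (fun x => x - ε x) 0
  obtain ⟨r, rfl⟩ : ∃ r, q = r + 1 := ⟨q - 1, by omega⟩
  have hstep : ∀ v, f v ≠ 0 → ‖f (ε v)‖ = 1 ∧ ‖g (ε v)‖ = 1 := by
    intro v hv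
    set w := (fun x => x - ε x)^[r + 1] v with hw
    have hvw := (h.norm_iterate_idempotent hq v).1
    have hεw := h.norm_iterate_idempotent hq (ε v)
    rw [iterate_sub_comm, ← hw] at hεw
    rw [← hw] at hvw
    have hle : ‖f w‖ ≤ ‖f (w - ε w)‖ := by
      have := h.norm_left_iterate_le r (w - ε w)
      rwa [← Function.iterate_succ_apply (fun x => x - ε x), hw, ← Function.iterate_add_apply,
        hq, ← hw] at this
    have heq := h.norm_left_sub w
    rw [le_antisymm (h.norm_left_sub_le w) hle] at heq
    have hpos : 0 < ‖f w‖ := by rw [hvw]; exact norm_pos_iff.2 hv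
    have h1 : ‖f (ε w)‖ * ‖g (ε w)‖ ^ 2 = 1 := by
      have := mul_left_cancel₀ hpos.ne' ((mul_one _).trans heq)
      exact this.symm
    obtain ⟨h2, h3⟩ := eq_one_of_mul_eq_one (norm_nonneg _) (h.left.norm_le _)
      (pow_le_one₀ (norm_nonneg _) (h.right.norm_le _)) h1
    rw [← hεw.1, ← hεw.2]
    exact ⟨h2, (pow_eq_one_iff_of_nonneg (norm_nonneg _) two_ne_zero).1 h3⟩
  have hiter : ∀ k v, f v ≠ 0 → ‖f (ε^[k + 1] v)‖ = 1 ∧ ‖g (ε^[k + 1] v)‖ = 1 := by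
    intro k
    induction k with
    | zero => exact hstep
    | succ k ih =>
      intro v hv
      refine ih (ε v) (norm_ne_zero_iff.1 ?_)
      rw [(hstep v hv).1]
      exact one_ne_zero
  have hmain : ∀ v, f v ≠ 0 → ‖f v‖ = 1 ∧ ‖g v‖ = 1 := by
    intro v hv
    obtain ⟨k, hk, hkv⟩ := hε.mem_periodicPts v
    obtain ⟨k, rfl⟩ : ∃ m, k = m + 1 := ⟨k - 1, by omega⟩
    have := hiter k v hv
    rwa [hkv.eq] at this
  refine ⟨hmain, fun v hv => ?_⟩
  obtain ⟨k, hk, hkv⟩ := hε.mem_periodicPts v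
  have hne : f (ε v) ≠ 0 := norm_ne_zero_iff.1 (by rw [hv]; exact one_ne_zero)
  obtain ⟨k, rfl⟩ : ∃ m, k = m + 1 := ⟨k - 1, by omega⟩
  have h1 : ε^[k] (ε v) = v := hkv.eq
  cases k with
  | zero => rw [← h1]; exact hv
  | succ k =>
    have := (hiter k _ hne).1
    rwa [h1] at this

end IsSkitovichPair

namespace IsSkitovichPair

lemma cocycle {Y : Type*} [AddCommGroup Y] {f g : Y → ℂ} {ε : Y →+ Y}
    (h : IsSkitovichPair ε f g) (hg : ∀ v, g v ≠ 0) (u v k : Y) :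
    f (u + v + (ε k - k)) * f u * f v * f (ε k - k) =
      f (u + v) * f (u + (ε k - k)) * f (v + (ε k - k)) := by
  have e1 := h.eqn u v
  have e2 := h.eqn (u + ε k) (v - k)
  have e3 := h.eqn (u + ε k) (-k)
  have e4 := h.eqn (ε k) (v - k)
  have e5 := h.eqn (ε k) (-k)
  rw [map_sub, show u + ε k + (v - k) = u + v + (ε k - k) by abel,
    show u + ε k + (ε v - ε k) = u + ε v by abel] at e2
  rw [map_neg, show u + ε k + -k = u + (ε k - k) by abel,
    show u + ε k + -ε k = u by abel] at e3
  rw [map_sub, show ε k + (v - k) = v + (ε k - k) by abel,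
    show ε k + (ε v - ε k) = ε v by abel] at e4
  rw [map_neg, add_neg_cancel, h.right.map_zero, mul_one, ← sub_eq_add_neg] at e5
  refine mul_right_cancel₀ (mul_ne_zero (mul_ne_zero (hg (u + ε v)) (hg u)) (hg (ε v))) ?_
  calc _ = (f (u + v + (ε k - k)) * g (u + ε v)) * f (ε k - k) * (f u * f v * g u * g (ε v)) := by
        ring
    _ = (f (u + (ε k - k)) * g u) * (f (v + (ε k - k)) * g (ε v)) * (f (u + v) * g (u + ε v)) := by
        rw [e1, e2, e3, e4, e5]; ring
    _ = _ := by ring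

/-- If `1 - ε` is surjective modulo the set where `|f| = 1`, then `f` satisfies the Gaussian
functional equation. -/
lemma gaussian_eqn {Y : Type*} [AddCommGroup Y] {f g : Y → ℂ} {ε : Y →+ Y}
    (h : IsSkitovichPair ε f g) (hg : ∀ v, g v ≠ 0)
    (hsurj : ∀ v, ∃ n w, v = n + (w - ε w) ∧ ‖f n‖ = 1) (u v : Y) :
    f (u + v) * f (u - v) = f u ^ 2 * (‖f v‖ : ℂ) ^ 2 := by
  obtain ⟨n, w, hv, hn⟩ := hsurj v
  have hc := h.cocycle hg u v w
  rw [show u + v + (ε w - w) = u + n by rw [hv]; abel,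
    show u + (ε w - w) = u - v + n by rw [hv]; abel,
    show v + (ε w - w) = 0 + n by rw [hv]; abel,
    show ε w - w = -v + n by rw [hv]; abel] at hc
  simp only [h.left.map_add n hn, h.left.map_zero, h.left.map_neg] at hc
  have hn0 : f n ≠ 0 := norm_ne_zero_iff.1 (by rw [hn]; exact one_ne_zero)
  rw [← Complex.mul_conj']
  refine mul_right_cancel₀ (mul_ne_zero hn0 hn0) ?_
  linear_combination -hc

lemma ne_zero_of_continuous {V : Type*} [NormedAddCommGroup V] [NormedSpace ℝ V]
    [FiniteDimensional ℝ V] {f g : V → ℂ} (ε : V ≃ₗ[ℝ] V) (h : IsSkitovichPair ε f g)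
    (hf : Continuous f) (hg : Continuous g) (s : V) : f s ≠ 0 ∧ g s ≠ 0 := by
  obtain ⟨r, hr, hball⟩ : ∃ r > 0, ∀ s : V, ‖s‖ < r → f s ≠ 0 ∧ g s ≠ 0 := by
    have h1 : ∀ᶠ s in nhds (0 : V), f s ≠ 0 ∧ g s ≠ 0 :=
      (hf.continuousAt.eventually_ne (by simp [h.left.map_zero])).and
        (hg.continuousAt.eventually_ne (by simp [h.right.map_zero]))
    obtain ⟨r, hr, hs⟩ := Metric.eventually_nhds_iff.1 h1
    exact ⟨r, hr, fun s hsr => hs (by simpa using hsr)⟩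
  obtain ⟨C, hC, hεC, hεC'⟩ : ∃ C : ℝ, 1 ≤ C ∧ (∀ v, ‖ε v‖ ≤ C * ‖v‖) ∧
      ∀ v, ‖ε.symm v‖ ≤ C * ‖v‖ := by
    let e := ε.toContinuousLinearEquiv
    refine ⟨1 + ‖(e : V →L[ℝ] V)‖ + ‖(e.symm : V →L[ℝ] V)‖, ?_, fun v => ?_, fun v => ?_⟩
    · linarith [norm_nonneg (e : V →L[ℝ] V), norm_nonneg (e.symm : V →L[ℝ] V)]
    · refine ((e : V →L[ℝ] V).le_opNorm v).trans ?_
      gcongr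
      linarith [norm_nonneg (e.symm : V →L[ℝ] V)]
    · refine ((e.symm : V →L[ℝ] V).le_opNorm v).trans ?_
      gcongr
      linarith [norm_nonneg (e : V →L[ℝ] V)]
  have hC0 : 0 < C := by linarith
  have hstep : ∀ ρ > 0, (∀ s : V, ‖s‖ < ρ → f s ≠ 0 ∧ g s ≠ 0) →
      ∀ s : V, ‖s‖ < ρ * (1 + C⁻¹) → f s ≠ 0 ∧ g s ≠ 0 := by
    intro ρ hρ hgood s hs
    have hCi : 0 < C⁻¹ := by positivity
    have hCi1 : C⁻¹ ≤ 1 := inv_le_one_of_one_le₀ hC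
    set c := (1 + C⁻¹)⁻¹ with hc
    have hc0 : 0 < c := by positivity
    have hsum : c + c * C⁻¹ = 1 := by
      rw [hc]; field_simp
    have hu : ‖c • s‖ < ρ := by
      rw [norm_smul, Real.norm_of_nonneg hc0.le]
      calc c * ‖s‖ < c * (ρ * (1 + C⁻¹)) := by gcongr
        _ = ρ * (c + c * C⁻¹) := by ring
        _ = ρ := by rw [hsum, mul_one]
    have hw : C * ‖(c * C⁻¹) • s‖ < ρ := by
      rw [norm_smul] at hu ⊢
      rw [Real.norm_of_nonneg hc0.le] at hu
      rw [Real.norm_of_nonneg (by positivity)]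
      calc C * (c * C⁻¹ * ‖s‖) = c * ‖s‖ := by field_simp
        _ < ρ := hu
    have hw' : ‖(c * C⁻¹) • s‖ < ρ :=
      (le_mul_of_one_le_left (norm_nonneg _) hC).trans_lt hw
    have hadd : c • s + (c * C⁻¹) • s = s := by rw [← add_smul, hsum, one_smul]
    have hprod : ∀ v, ‖v‖ < ρ → ‖ε v‖ < ρ →
        f (c • s + v) ≠ 0 ∧ g (c • s + ε v) ≠ 0 := by
      intro v hv hv'
      have := h.eqn (c • s) v
      exact mul_ne_zero_iff.1 (this ▸ mul_ne_zero (mul_ne_zero (mul_ne_zero (hgood _ hu).1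
        (hgood _ hv).1) (hgood _ hu).2) (hgood _ hv').2)
    constructor
    · have := (hprod _ hw' ((hεC _).trans_lt hw)).1
      rwa [hadd] at this
    · have := (hprod (ε.symm ((c * C⁻¹) • s)) ((hεC' _).trans_lt hw) (by simpa using hw')).2
      rwa [ε.apply_symm_apply, hadd] at this
  have hiter : ∀ k : ℕ, ∀ s : V, ‖s‖ < r * (1 + C⁻¹) ^ k → f s ≠ 0 ∧ g s ≠ 0 := by
    intro k
    induction k with
    | zero => simpa using hball
    | succ k ih =>
      intro s hs
      refine hstep _ (by positivity) ih s ?_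
      rwa [mul_assoc, ← pow_succ]
  obtain ⟨k, hk⟩ := pow_unbounded_of_one_lt (‖s‖ / r)
    (show 1 < 1 + C⁻¹ by linarith [show 0 < C⁻¹ by positivity])
  exact hiter k s (by rwa [div_lt_iff₀' hr] at hk)

lemma exists_iterate_range {V : Type*} [AddCommGroup V] [Module ℝ V] [FiniteDimensional ℝ V]
    (T : Module.End ℝ V) : ∃ N, ∀ q ≥ N, ∀ s, ∃ s', T^[q] s = T^[q + q] s' := by
  obtain ⟨N, hN⟩ := Filter.eventually_atTop.1 T.eventually_iInf_range_pow_eq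
  refine ⟨N, fun q hq s => ?_⟩
  have h1 : LinearMap.range (T ^ q) = LinearMap.range (T ^ (q + q)) := by
    rw [← hN q hq, ← hN (q + q) (by omega)]
  obtain ⟨s', hs'⟩ : (T ^ q) s ∈ LinearMap.range (T ^ (q + q)) := h1 ▸ LinearMap.mem_range_self _ _
  exact ⟨s', by rw [← Module.End.pow_apply, ← Module.End.pow_apply, hs']⟩

/-- The structure of the left member of a Skitovich pair on the product of a vector space and a
finite group. -/
theorem left_structure {V H : Type*} [NormedAddCommGroup V] [NormedSpace ℝ V]
    [FiniteDimensional ℝ V] [AddCommGroup H] [Finite H] (εV : V ≃ₗ[ℝ] V) (εH : H ≃+ H)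
    {f g : V × H → ℂ} (h : IsSkitovichPair (Prod.map εV εH) f g)
    (hf : Continuous fun s => f (s, 0)) (hg : Continuous fun s => g (s, 0)) :
    (∀ χ, f (0, χ) = 0 ∨ ‖f (0, χ)‖ = 1) ∧ (∀ s χ, f (s, χ) = f (s, 0) * f (0, χ)) ∧
      (∀ s, f (s, 0) ≠ 0) ∧
      ∀ u v, f (u + v, 0) * f (u - v, 0) = f (u, 0) ^ 2 * (‖f (v, 0)‖ : ℂ) ^ 2 := by
  have hV : IsSkitovichPair εV (f ∘ AddMonoidHom.inl V H) (g ∘ AddMonoidHom.inl V H) :=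
    h.comp _ fun s => by simp
  have hH : IsSkitovichPair (εH : H →+ H) (f ∘ AddMonoidHom.inr V H) (g ∘ AddMonoidHom.inr V H) :=
    h.comp _ fun s => by simp
  have hne := hV.ne_zero_of_continuous εV hf hg
  obtain ⟨hH1, hH2⟩ := hH.norm_eq_one_of_finite εH.injective
  simp only [Function.comp_apply, AddMonoidHom.inr_apply, AddMonoidHom.inl_apply,
    AddMonoidHom.coe_coe] at hne hH1 hH2
  obtain ⟨N, hN⟩ := exists_iterate_range (1 - (εV : V →ₗ[ℝ] V) : Module.End ℝ V)
  obtain ⟨q, hq0, hqN, hq⟩ := exists_iterate_idempotent (fun x => x - (εH : H →+ H) x) N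
  obtain ⟨r, rfl⟩ : ∃ r, q = r + 1 := ⟨q - 1, by omega⟩
  have hqV : ∀ s, ∃ s', (fun x => x - εV x)^[r + 1] s =
      (fun x => x - εV x)^[r + 1 + (r + 1)] s' := hN _ hqN
  have hV' : IsSkitovichPair (εV : V →ₗ[ℝ] V).toAddMonoidHom (f ∘ AddMonoidHom.inl V H)
    (g ∘ AddMonoidHom.inl V H) := hV
  set ε : V × H →+ V × H := (εV : V →ₗ[ℝ] V).toAddMonoidHom.prodMap (εH : H →+ H) with hε
  have h' : IsSkitovichPair ε f g := h
  have hiter : ∀ k (s : V) (χ : H), (fun x => x - ε x)^[k] (s, χ) =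
      ((fun x => x - εV x)^[k] s, (fun x => x - (εH : H →+ H) x)^[k] χ) := by
    intro k
    induction k with
    | zero => exact fun _ _ => rfl
    | succ k ih => exact fun s χ => ih _ _
  have hzero : ∀ s χ, f (s, χ) ≠ 0 → ‖f (0, χ)‖ = 1 := by
    intro s χ hs
    obtain ⟨s', hs'⟩ := hqV s
    set Tχ := (fun x => x - (εH : H →+ H) x)^[r] χ with hTχ
    set Ts := (fun x => x - εV x)^[r] s' with hTs
    have hn : (fun x => x - ε x)^[r + 1] ((s, χ) - (fun x => x - ε x)^[r + 1] (s', χ)) = 0 := by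
      rw [iterate_sub_sub, ← Function.iterate_add_apply, hiter, hiter, hs', hq, sub_self]
    have hnorm := (h'.norm_add_of_iterate hn ((fun x => x - ε x)^[r + 1] (s', χ))).1
    rw [add_sub_cancel, Function.iterate_succ_apply', hiter, ← hTχ, ← hTs] at hnorm
    have hsub := h'.norm_left_sub (Ts, Tχ)
    rw [← hnorm] at hsub
    have hne1 : f (ε (Ts, Tχ)) ≠ 0 ∧ g (ε (Ts, Tχ)) ≠ 0 := by
      have h1 := norm_ne_zero_iff.2 hs
      rw [hsub] at h1
      simpa using (mul_ne_zero_iff.1 h1).2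
    have hne2 : f (0, εH Tχ) ≠ 0 := by
      have heq := h.eqn (εV Ts, εH Tχ) (-εV Ts, 0)
      have h1 : (εV Ts, εH Tχ) + (-εV Ts, (0 : H)) = (0, εH Tχ) := by simp
      rw [h1] at heq
      refine left_ne_zero_of_mul (heq ▸ mul_ne_zero (mul_ne_zero (mul_ne_zero hne1.1
        (hne _).1) hne1.2) ?_)
      simpa using (hne _).2
    have h1 : ‖f (0, Tχ)‖ = 1 := hH2 _ (hH1 _ hne2).1
    have h2 : ‖f (0, Tχ - εH Tχ)‖ = 1 := hH.left.norm_sub_eq_one h1 (hH1 _ hne2).1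
    have h3 := (hH.norm_iterate_idempotent hq χ).1
    rw [Function.iterate_succ_apply', ← hTχ] at h3
    exact h3.symm.trans h2
  refine ⟨fun χ => ?_, fun s χ => ?_, fun s => (hne s).1, fun u v => ?_⟩
  · by_cases h0 : f (0, χ) = 0
    · exact Or.inl h0
    · exact Or.inr (hH1 _ h0).1
  · by_cases h1 : ‖f (0, χ)‖ = 1
    · simpa using h.left.map_add _ h1 (s, 0)
    · have h0 : f (0, χ) = 0 := by
        by_contra h0
        exact h1 (hH1 _ h0).1
      rw [h0, mul_zero]
      by_contra h2
      exact h1 (hzero s χ h2)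
  · refine hV'.gaussian_eqn (fun v => (hne v).2) (fun v => ?_) u v
    obtain ⟨s', hs'⟩ := hqV v
    refine ⟨v - (fun x => x - εV x)^[r + 1] s', (fun x => x - εV x)^[r] s', ?_, ?_⟩
    · rw [Function.iterate_succ_apply']
      simp
    · refine (hV'.norm_eq_one_of_iterate (r + 1) _ ?_).1
      refine (iterate_sub_sub _ _ _ _).trans ?_
      simp only [LinearMap.toAddMonoidHom_coe, LinearEquiv.coe_coe]
      rw [← Function.iterate_add_apply, hs', sub_self]

end IsSkitovichPair

/-- The character `(x, h) ↦ exp(i⟨s, x⟩) χ(h)` of `ℝⁿ × F` with parameter `p = (s, χ)`. -/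
noncomputable def pairing {n : ℕ} {F : Type*} [AddCommGroup F]
    (p : (Fin n → ℝ) × AddChar F ℂ) (x : (Fin n → ℝ) × F) : ℂ :=
  (Circle.exp (p.1 ⬝ᵥ x.1) : ℂ) * p.2 x.2

/-- The characteristic function of a measure on `ℝⁿ × F` in the coordinates of `pairing`. -/
noncomputable def pairingInt {n : ℕ} {F : Type*} [AddCommGroup F] [MeasurableSpace F]
    (μ : Measure ((Fin n → ℝ) × F)) (p : (Fin n → ℝ) × AddChar F ℂ) : ℂ :=
  ∫ x, pairing p x ∂μ

section Pairing

variable {n : ℕ} {F : Type*} [AddCommGroup F]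

lemma pairing_zero_left (x : (Fin n → ℝ) × F) : pairing 0 x = 1 := by
  simp [pairing]

lemma pairing_add_left (p q : (Fin n → ℝ) × AddChar F ℂ) (x : (Fin n → ℝ) × F) :
    pairing (p + q) x = pairing p x * pairing q x := by
  simp only [pairing, Prod.fst_add, Prod.snd_add, add_dotProduct, Circle.exp_add, Circle.coe_mul,
    AddChar.add_apply]
  ring

lemma pairing_add_right (p : (Fin n → ℝ) × AddChar F ℂ) (x y : (Fin n → ℝ) × F) :
    pairing p (x + y) = pairing p x * pairing p y := by
  simp only [pairing, Prod.fst_add, Prod.snd_add, dotProduct_add, Circle.exp_add, Circle.coe_mul,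
    AddChar.map_add_eq_mul]
  ring

lemma continuous_coe_circleExp : Continuous fun t : ℝ => (Circle.exp t : ℂ) := by
  simp only [Circle.coe_exp]
  fun_prop

lemma continuous_pairing [TopologicalSpace F] [DiscreteTopology F]
    (p : (Fin n → ℝ) × AddChar F ℂ) : Continuous (pairing p) := by
  unfold pairing
  have h1 : Continuous fun x : (Fin n → ℝ) × F => p.1 ⬝ᵥ x.1 := by
    simp only [dotProduct]; fun_prop
  have h2 : Continuous fun x : F => p.2 x := continuous_of_discreteTopology
  exact (continuous_coe_circleExp.comp h1).mul (h2.comp continuous_snd)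

variable [Finite F]

lemma norm_pairing (p : (Fin n → ℝ) × AddChar F ℂ) (x : (Fin n → ℝ) × F) :
    ‖pairing p x‖ = 1 := by
  simp [pairing]

lemma pairing_neg_left (p : (Fin n → ℝ) × AddChar F ℂ) (x : (Fin n → ℝ) × F) :
    pairing (-p) x = (starRingEnd ℂ) (pairing p x) := by
  have h1 : pairing (-p) x * pairing p x = 1 := by
    rw [← pairing_add_left, neg_add_cancel, pairing_zero_left]
  have h2 : (starRingEnd ℂ) (pairing p x) * pairing p x = 1 := by
    rw [Complex.conj_mul', norm_pairing]; simp
  have h3 : pairing p x ≠ 0 := norm_ne_zero_iff.1 (by rw [norm_pairing]; exact one_ne_zero)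
  exact mul_right_cancel₀ h3 (h1.trans h2.symm)

lemma ae_pairing_eq [MeasurableSpace F] (μ : Measure ((Fin n → ℝ) × F)) [IsProbabilityMeasure μ]
    {p : (Fin n → ℝ) × AddChar F ℂ} (hp : ‖pairingInt μ p‖ = 1) :
    ∀ᵐ x ∂μ, pairing p x = pairingInt μ p := by
  rcases ae_eq_const_or_norm_integral_lt_of_norm_le_const
    (ae_of_all μ fun x => (norm_pairing p x).le) with h | h
  · simpa [Filter.EventuallyEq, pairingInt, average_eq_integral] using h
  · rw [pairingInt] at hp
    simp [hp] at h

lemma isCharLike_pairingInt [MeasurableSpace F] (μ : Measure ((Fin n → ℝ) × F))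
    [IsProbabilityMeasure μ] :
    IsCharLike (pairingInt μ) where
  map_zero := by simp [pairingInt, pairing_zero_left]
  norm_le u := by
    simpa [pairingInt] using norm_integral_le_of_norm_le_const (μ := μ)
      (ae_of_all _ fun x => (norm_pairing u x).le)
  map_neg u := by
    simp only [pairingInt, pairing_neg_left]
    exact integral_conj
  map_add v hv u := by
    have h : ∀ᵐ x ∂μ, pairing (u + v) x = pairing u x * pairingInt μ v := by
      filter_upwards [ae_pairing_eq μ hv] with x hx
      rw [pairing_add_left, hx]
    rw [pairingInt, integral_congr_ae h, integral_mul_const]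
    rfl

variable [TopologicalSpace F] [DiscreteTopology F] [MeasurableSpace F] [BorelSpace F]

lemma measurable_pairing (p : (Fin n → ℝ) × AddChar F ℂ) : Measurable (pairing p) :=
  (continuous_pairing p).measurable

lemma integrable_pairing (μ : Measure ((Fin n → ℝ) × F)) [IsFiniteMeasure μ]
    (p : (Fin n → ℝ) × AddChar F ℂ) : Integrable (pairing p) μ :=
  Integrable.of_bound (measurable_pairing p).aestronglyMeasurable 1
    (ae_of_all _ fun x => (norm_pairing p x).le)

lemma pairingInt_map {Ω : Type*} [MeasurableSpace Ω] (P : Measure Ω)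
    {ξ : Ω → (Fin n → ℝ) × F} (hξ : Measurable ξ) (p : (Fin n → ℝ) × AddChar F ℂ) :
    pairingInt (P.map ξ) p = ∫ ω, pairing p (ξ ω) ∂P :=
  integral_map hξ.aemeasurable (measurable_pairing p).aestronglyMeasurable

lemma continuous_pairingInt (μ : Measure ((Fin n → ℝ) × F)) [IsFiniteMeasure μ] :
    Continuous fun s => pairingInt μ (s, 0) := by
  refine continuous_of_dominated (bound := fun _ => 1)
    (fun s => (measurable_pairing _).aestronglyMeasurable)
    (fun s => ae_of_all _ fun x => (norm_pairing _ x).le) (integrable_const _)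
    (ae_of_all _ fun x => ?_)
  simp only [pairing]
  have h1 : Continuous fun s : Fin n → ℝ => s ⬝ᵥ x.1 := by
    simp only [dotProduct]; fun_prop
  exact (continuous_coe_circleExp.comp h1).mul continuous_const

/-- A finite measure on `ℝⁿ × F` is determined by its characteristic function. -/
lemma ext_of_pairingInt {μ ν : Measure ((Fin n → ℝ) × F)} [IsFiniteMeasure μ] [IsFiniteMeasure ν]
    (h : ∀ p, pairingInt μ p = pairingInt ν p) : μ = ν := by
  classical
  have := Fintype.ofFinite F
  have hslice : ∀ (κ : Measure ((Fin n → ℝ) × F)) [IsFiniteMeasure κ] (a : F) (s : Fin n → ℝ),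
      ∫ x, (Circle.exp (x ⬝ᵥ s) : ℂ) ∂(κ.restrict (Prod.snd ⁻¹' {a})).map Prod.fst =
        (Fintype.card F : ℂ)⁻¹ * ∑ χ : AddChar F ℂ, χ (-a) * pairingInt κ (s, χ) := by
    intro κ _ a s
    have hcont : Continuous fun x : Fin n → ℝ => (Circle.exp (x ⬝ᵥ s) : ℂ) := by
      have h1 : Continuous fun x : Fin n → ℝ => x ⬝ᵥ s := by
        simp only [dotProduct]; fun_prop
      exact continuous_coe_circleExp.comp h1
    rw [integral_map measurable_fst.aemeasurable hcont.aestronglyMeasurable,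
      ← integral_indicator (measurable_snd (measurableSet_singleton a))]
    simp only [pairingInt, ← integral_const_mul]
    rw [← integral_finsetSum _ fun χ _ => (integrable_pairing κ _).const_mul _,
      ← integral_const_mul]
    congr 1 with x
    have hsum : ∑ χ : AddChar F ℂ, χ (-a) * pairing (s, χ) x =
        (Circle.exp (x.1 ⬝ᵥ s) : ℂ) * ∑ χ : AddChar F ℂ, χ (x.2 - a) := by
      rw [Finset.mul_sum]
      refine Finset.sum_congr rfl fun χ _ => ?_
      simp only [pairing, sub_eq_add_neg, AddChar.map_add_eq_mul, dotProduct_comm x.1 s]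
      ring
    rw [hsum, AddChar.sum_apply_eq_ite, Set.indicator_apply]
    by_cases hx : x.2 = a
    · simp [hx, mul_comm]
    · simp [hx, sub_eq_zero]
  have heq : ∀ a : F, (μ.restrict (Prod.snd ⁻¹' {a})).map Prod.fst =
      (ν.restrict (Prod.snd ⁻¹' {a})).map Prod.fst := by
    intro a
    refine ext_of_integral_char_eq (L := dotProductBilin ℝ ℝ) Real.continuous_probChar
      Real.probChar_ne_one ?_ ?_ fun s => ?_
    · intro v hv hv'
      exact hv (dotProduct_self_eq_zero.1 (LinearMap.congr_fun hv' v))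
    · simp only [dotProductBilin, dotProduct, LinearMap.coe_mk, AddHom.coe_mk]
      fun_prop
    · have h1 := hslice μ a s
      simp only [h] at h1
      exact h1.trans (hslice ν a s).symm
  ext A hA
  have hdecomp : ∀ κ : Measure ((Fin n → ℝ) × F), κ A =
      ∑ a : F, (κ.restrict (Prod.snd ⁻¹' {a})).map Prod.fst ((fun x => (x, a)) ⁻¹' A) := by
    intro κ
    have hA' : A = ⋃ a ∈ (Finset.univ : Finset F), A ∩ Prod.snd ⁻¹' {a} := by
      ext x; simp
    conv_lhs => rw [hA']
    rw [measure_biUnion_finset]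
    · refine Finset.sum_congr rfl fun a _ => ?_
      have hm : MeasurableSet ((fun x : Fin n → ℝ => (x, a)) ⁻¹' A) :=
        measurable_prodMk_right hA
      rw [Measure.map_apply measurable_fst hm, Measure.restrict_apply (measurable_fst hm)]
      congr 1
      ext x
      constructor
      · rintro ⟨hx, rfl⟩
        exact ⟨hx, rfl⟩
      · rintro ⟨hx, rfl⟩
        exact ⟨hx, rfl⟩
    · intro a _ b _ hab
      refine Set.disjoint_left.2 ?_
      rintro x ⟨-, hx⟩ ⟨-, hx'⟩
      exact hab (hx.symm.trans hx')
    · exact fun a _ => hA.inter (measurable_snd (measurableSet_singleton a))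
  rw [hdecomp μ, hdecomp ν]
  simp only [heq]

end Pairing

/-- Continuous characters of `ℝⁿ` are exponentials of linear functionals. -/
lemma exists_exp_dotProduct {n : ℕ} (p : (Fin n → ℝ) → Circle) (hp : Continuous p)
    (hadd : ∀ x y, p (x + y) = p x * p y) :
    ∃ a : Fin n → ℝ, ∀ x, p x = Circle.exp (a ⬝ᵥ x) := by
  have hp0 : p 0 = 1 := by simpa using hadd 0 0
  obtain ⟨θ, ⟨hθ0, hθ⟩, -⟩ := Circle.isCoveringMap_exp.existsUnique_continuousMap_lifts
    (⟨p, hp⟩ : C(Fin n → ℝ, Circle)) 0 0 (by simp [hp0])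
  have hθ' : ∀ x, Circle.exp (θ x) = p x := fun x => congrFun hθ x
  have hθadd : ∀ x y, θ (x + y) = θ x + θ y := by
    intro x y
    have h1 : (fun y => θ (x + y)) = fun y => θ x + θ y := by
      refine Circle.isCoveringMap_exp.eq_of_comp_eq (by fun_prop) (by fun_prop) ?_ 0 (by simp [hθ0])
      funext y
      simp [hθ', Circle.exp_add, hadd]
    exact congrFun h1 y
  let L : (Fin n → ℝ) →L[ℝ] ℝ :=
    AddMonoidHom.toRealLinearMap ⟨⟨θ, hθ0⟩, hθadd⟩ θ.continuous
  refine ⟨fun i => L (Pi.single i 1), fun x => ?_⟩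
  rw [← hθ']
  congr 1
  have h1 : θ x = L x := rfl
  rw [h1]
  conv_lhs => rw [← Finset.univ_sum_single x, map_sum]
  refine Finset.sum_congr rfl fun i _ => ?_
  have h2 : Pi.single i (x i) = x i • (Pi.single i 1 : Fin n → ℝ) := by
    rw [← Pi.single_smul]; simp
  rw [h2, map_smul, smul_eq_mul, mul_comm]

section Structure

lemma exists_dual_eq_exp {n : ℕ} {F : Type*} [AddCommGroup F] [TopologicalSpace F]
    (y : Dual ((Fin n → ℝ) × F)) :
    ∃ s : Fin n → ℝ, ∀ x, y (Multiplicative.ofAdd (x, 0)) = Circle.exp (s ⬝ᵥ x) := by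
  refine exists_exp_dotProduct _ ?_ fun x x' => ?_
  · exact (map_continuous y).comp
      (continuous_ofAdd.comp (continuous_id.prodMk continuous_const))
  · rw [← map_mul, ← ofAdd_add]
    simp

variable {n : ℕ} {F : Type*} [AddCommGroup F] [Finite F]

/-- Continuous endomorphisms of `ℝⁿ × F` are diagonal. -/
lemma exists_eq_prodMap [TopologicalSpace F] (δ : (Fin n → ℝ) × F →+ (Fin n → ℝ) × F)
    (hδ : Continuous δ) :
    ∃ (L : (Fin n → ℝ) →ₗ[ℝ] (Fin n → ℝ)) (d : F →+ F), ∀ x, δ x = (L x.1, d x.2) := by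
  have hcard : (Nat.card F : ℝ) ≠ 0 := Nat.cast_ne_zero.2 Nat.card_pos.ne'
  have h1 : ∀ x : Fin n → ℝ, (δ (x, 0)).2 = 0 := by
    intro x
    have hx : ((x, 0) : (Fin n → ℝ) × F) = Nat.card F • (((Nat.card F : ℝ)⁻¹ • x, 0)) := by
      ext1
      · simp [← Nat.cast_smul_eq_nsmul ℝ, smul_smul, hcard]
      · simp
    rw [hx, map_nsmul, Prod.smul_snd, card_nsmul_eq_zero']
  have h2 : ∀ a : F, (δ (0, a)).1 = 0 := by
    intro a
    have ha : Nat.card F • (δ (0, a)).1 = 0 := by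
      rw [← Prod.smul_fst, ← map_nsmul]
      have : Nat.card F • ((0 : Fin n → ℝ), a) = 0 := by
        ext1
        · simp
        · simp [card_nsmul_eq_zero']
      simp [this]
    rw [← Nat.cast_smul_eq_nsmul ℝ] at ha
    exact (smul_eq_zero.1 ha).resolve_left hcard
  let L : (Fin n → ℝ) →+ (Fin n → ℝ) :=
    (AddMonoidHom.fst _ F).comp (δ.comp (AddMonoidHom.inl _ F))
  have hL : Continuous L :=
    continuous_fst.comp (hδ.comp (continuous_id.prodMk continuous_const))
  refine ⟨(L.toRealLinearMap hL : (Fin n → ℝ) →L[ℝ] (Fin n → ℝ)),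
    (AddMonoidHom.snd (Fin n → ℝ) F).comp (δ.comp (AddMonoidHom.inr _ F)), fun x => ?_⟩
  have hx : x = (x.1, 0) + (0, x.2) := by ext1 <;> simp
  conv_lhs => rw [hx, map_add]
  ext1
  · simp [h2, L]
  · simp [h1]

/-- The adjoint of a topological automorphism of `ℝⁿ × F`. -/
lemma exists_adjoint [TopologicalSpace F] (δ : ((Fin n → ℝ) × F) ≃+ ((Fin n → ℝ) × F))
    (hδ : Continuous δ) (hδ' : Continuous δ.symm) :
    ∃ (εV : (Fin n → ℝ) ≃ₗ[ℝ] (Fin n → ℝ)) (εH : AddChar F ℂ ≃+ AddChar F ℂ),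
      ∀ p x, pairing p (δ x) = pairing (Prod.map εV εH p) x := by
  obtain ⟨L, d, h⟩ := exists_eq_prodMap (δ : (Fin n → ℝ) × F →+ (Fin n → ℝ) × F) hδ
  obtain ⟨L', d', h'⟩ := exists_eq_prodMap (δ.symm : (Fin n → ℝ) × F →+ (Fin n → ℝ) × F) hδ'
  simp only [AddMonoidHom.coe_coe] at h h'
  have h1 : ∀ x, (L (L' x.1), d (d' x.2)) = x := by
    intro x
    have := δ.apply_symm_apply x
    rwa [h', h] at this
  have h2 : ∀ x, (L' (L x.1), d' (d x.2)) = x := by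
    intro x
    have := δ.symm_apply_apply x
    rwa [h, h'] at this
  have hLL' : L ∘ₗ L' = LinearMap.id := by
    ext1 x
    ext1
    simpa using congrArg Prod.fst (h1 (Pi.single x 1, 0))
  have hL'L : L' ∘ₗ L = LinearMap.id := by
    ext1 x
    ext1
    simpa using congrArg Prod.fst (h2 (Pi.single x 1, 0))
  have hmul : LinearMap.toMatrix' L * LinearMap.toMatrix' L' = 1 := by
    rw [← LinearMap.toMatrix'_comp, hLL', LinearMap.toMatrix'_id]
  have hmul' : LinearMap.toMatrix' L' * LinearMap.toMatrix' L = 1 := by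
    rw [← LinearMap.toMatrix'_comp, hL'L, LinearMap.toMatrix'_id]
  refine ⟨LinearEquiv.ofLinearMap (LinearMap.toMatrix' L).vecMulLinear
      (LinearMap.toMatrix' L').vecMulLinear ?_ ?_,
    { toFun := fun χ => χ.compAddMonoidHom d
      invFun := fun χ => χ.compAddMonoidHom d'
      left_inv := fun χ => ?_
      right_inv := fun χ => ?_
      map_add' := fun χ ψ => ?_ }, fun p x => ?_⟩
  · refine LinearMap.ext fun s => ?_
    simp [Matrix.vecMul_vecMul, hmul']
  · refine LinearMap.ext fun s => ?_
    simp [Matrix.vecMul_vecMul, hmul]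
  · ext a
    simpa using congrArg χ (congrArg Prod.snd (h1 (0, a)))
  · ext a
    simpa using congrArg χ (congrArg Prod.snd (h2 (0, a)))
  · ext a
    simp
  · simp [pairing, h, ← Matrix.dotProduct_mulVec]

variable [TopologicalSpace F] [DiscreteTopology F] [MeasurableSpace F] [BorelSpace F]

lemma measurable_add_prod {Ω : Type*} [MeasurableSpace Ω] {ξ η : Ω → (Fin n → ℝ) × F}
    (hξ : Measurable ξ) (hη : Measurable η) : Measurable fun ω => ξ ω + η ω := by
  have : ContinuousAdd F := ⟨continuous_of_discreteTopology⟩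
  exact hξ.add hη

lemma pairingInt_conv (μ ν : Measure ((Fin n → ℝ) × F)) [IsFiniteMeasure μ] [IsFiniteMeasure ν]
    (p : (Fin n → ℝ) × AddChar F ℂ) :
    pairingInt (μ.conv ν) p = pairingInt μ p * pairingInt ν p := by
  rw [Measure.conv, pairingInt_map _ (measurable_add_prod measurable_fst measurable_snd)]
  simp only [pairing_add_right]
  exact integral_prod_mul _ _

/-- Independence of `ξ + η` and `ξ + δη` as a functional equation. -/
lemma isSkitovichPair_of_indepFun {Ω : Type*} [MeasurableSpace Ω] (P : Measure Ω)
    [IsProbabilityMeasure P] {ξ η : Ω → (Fin n → ℝ) × F} (hξ : Measurable ξ) (hη : Measurable η)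
    (hindep : IndepFun ξ η P) (δ : (Fin n → ℝ) × F → (Fin n → ℝ) × F) (hδ : Measurable δ)
    (ε : (Fin n → ℝ) × AddChar F ℂ → (Fin n → ℝ) × AddChar F ℂ)
    (hε : ∀ p x, pairing p (δ x) = pairing (ε p) x)
    (hL : IndepFun (fun ω => ξ ω + η ω) (fun ω => ξ ω + δ (η ω)) P) :
    IsSkitovichPair ε (pairingInt (P.map ξ)) (pairingInt (P.map η)) := by
  have := Measure.isProbabilityMeasure_map (μ := P) hξ.aemeasurable
  have := Measure.isProbabilityMeasure_map (μ := P) hη.aemeasurable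
  refine ⟨isCharLike_pairingInt _, isCharLike_pairingInt _, fun u v => ?_⟩
  have hmul : ∀ {X Y : Ω → (Fin n → ℝ) × F}, Measurable X → Measurable Y → IndepFun X Y P →
      ∀ p q, ∫ ω, pairing p (X ω) * pairing q (Y ω) ∂P =
        (∫ ω, pairing p (X ω) ∂P) * ∫ ω, pairing q (Y ω) ∂P := by
    intro X Y hX hY hXY p q
    exact (hXY.comp (measurable_pairing p) (measurable_pairing q)).integral_fun_mul_eq_mul_integral
      ((measurable_pairing p).comp hX).aestronglyMeasurable
      ((measurable_pairing q).comp hY).aestronglyMeasurable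
  have h1 := hmul (measurable_add_prod hξ hη) (measurable_add_prod hξ (hδ.comp hη)) hL u v
  have h2 : ∀ ω, pairing u (ξ ω + η ω) * pairing v (ξ ω + δ (η ω)) =
      pairing (u + v) (ξ ω) * pairing (u + ε v) (η ω) := by
    intro ω
    simp only [pairing_add_right, pairing_add_left, hε]
    ring
  simp only [Function.comp_def, h2] at h1
  simp only [pairing_add_right, hε] at h1
  rw [hmul hξ hη hindep, hmul hξ hη hindep, hmul hξ hη hindep] at h1
  simp only [pairingInt_map P hξ, pairingInt_map P hη]
  rw [h1]
  ring

/-- A distribution on the finite factor whose characteristic function has modulus `0` or `1`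
is idempotent. -/
lemma isIdempotentDist_of_norm (ι : Measure ((Fin n → ℝ) × F)) [IsProbabilityMeasure ι]
    (hsupp : ∀ᵐ x ∂ι, x.1 = 0)
    (h : ∀ χ, pairingInt ι (0, χ) = 0 ∨ ‖pairingInt ι (0, χ)‖ = 1) : IsIdempotentDist ι := by
  have hfst : ∀ s χ, pairingInt ι (s, χ) = pairingInt ι (0, χ) := by
    intro s χ
    refine integral_congr_ae ?_
    filter_upwards [hsupp] with x hx
    simp [pairing, hx]
  have hae : ∀ᵐ x ∂ι, x.1 = 0 ∧ ∀ χ : AddChar F ℂ, ‖pairingInt ι (0, χ)‖ = 1 →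
      χ x.2 = pairingInt ι (0, χ) := by
    refine hsupp.and (ae_all_iff.2 fun χ => ?_)
    by_cases hχ : ‖pairingInt ι (0, χ)‖ = 1
    · filter_upwards [ae_pairing_eq ι hχ] with x hx _
      rw [← hx]
      simp [pairing]
    · exact ae_of_all _ fun x hx => absurd hx hχ
  obtain ⟨x₀, hx₀, hx₀'⟩ := hae.exists
  let K : AddSubgroup ((Fin n → ℝ) × F) :=
    { carrier := {k | k.1 = 0 ∧ ∀ χ : AddChar F ℂ, ‖pairingInt ι (0, χ)‖ = 1 → χ k.2 = 1}
      zero_mem' := by simp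
      add_mem' := by
        rintro a b ⟨ha, ha'⟩ ⟨hb, hb'⟩
        refine ⟨by simp [ha, hb], fun χ hχ => ?_⟩
        rw [Prod.snd_add, AddChar.map_add_eq_mul, ha' χ hχ, hb' χ hχ, one_mul]
      neg_mem' := by
        rintro a ⟨ha, ha'⟩
        refine ⟨by simp [ha], fun χ hχ => ?_⟩
        rw [Prod.snd_neg, AddChar.map_neg_eq_inv, ha' χ hχ, inv_one] }
  have hKfin : (K : Set ((Fin n → ℝ) × F)).Finite := by
    refine (Set.finite_range fun a : F => ((0 : Fin n → ℝ), a)).subset ?_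
    rintro k ⟨hk, -⟩
    exact ⟨k.2, by ext1 <;> simp [hk]⟩
  have hshift : ∀ x : (Fin n → ℝ) × F, Measurable fun z => x + z := fun x =>
    measurable_add_prod measurable_const measurable_id
  have hpm : IsProbabilityMeasure (ι.map fun z => -x₀ + z) :=
    Measure.isProbabilityMeasure_map (hshift _).aemeasurable
  refine ⟨K, ι.map fun z => -x₀ + z, x₀, hKfin.isCompact, hpm, ?_, fun k hk => ?_, ?_⟩
  · rw [Measure.map_apply (hshift _) hKfin.measurableSet]
    refine (prob_compl_eq_zero_iff ((hshift _) hKfin.measurableSet)).1 ?_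
    refine (measure_eq_zero_iff_ae_notMem).2 ?_
    filter_upwards [hae] with x hx
    simp only [Set.mem_compl_iff, not_not]
    refine ⟨by simp [hx.1, hx₀], fun χ hχ => ?_⟩
    rw [Prod.snd_add, AddChar.map_add_eq_mul, Prod.snd_neg, AddChar.map_neg_eq_inv, hx.2 χ hχ,
      hx₀' χ hχ, inv_mul_cancel₀]
    exact norm_ne_zero_iff.1 (by rw [hχ]; exact one_ne_zero)
  · have := Measure.isProbabilityMeasure_map (μ := ι.map fun z => -x₀ + z) (hshift k).aemeasurable
    refine ext_of_pairingInt fun p => ?_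
    have hp : pairingInt (ι.map fun z => -x₀ + z) p = pairing p (-x₀) * pairingInt ι p := by
      rw [pairingInt_map _ (hshift _)]
      simp only [pairing_add_right]
      exact integral_const_mul _ _
    have hp' : pairingInt ((ι.map fun z => -x₀ + z).map fun z => k + z) p =
        pairing p k * pairingInt (ι.map fun z => -x₀ + z) p := by
      rw [pairingInt_map _ (hshift _)]
      simp only [pairing_add_right]
      exact integral_const_mul _ _
    rw [hp', hp]
    have hp0 : pairingInt ι p = pairingInt ι (0, p.2) := hfst p.1 p.2
    rcases h p.2 with h0 | h1
    · simp [hp0, h0]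
    · have : pairing p k = 1 := by simp [pairing, hk.1, hk.2 _ h1]
      rw [this, one_mul]
  · rw [Measure.map_map (hshift _) (hshift _)]
    simp [Function.comp_def]

instance secondCountableTopology_dual : SecondCountableTopology (Dual ((Fin n → ℝ) × F)) := by
  have : LocallyCompactSpace (Multiplicative ((Fin n → ℝ) × F)) :=
    inferInstanceAs (LocallyCompactSpace ((Fin n → ℝ) × F))
  have : SecondCountableTopology (Multiplicative ((Fin n → ℝ) × F)) :=
    inferInstanceAs (SecondCountableTopology ((Fin n → ℝ) × F))
  exact (ContinuousMonoidHom.isInducing_toContinuousMap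
    (Multiplicative ((Fin n → ℝ) × F)) Circle).secondCountableTopology

lemma continuous_charFun_dual (μ : Measure ((Fin n → ℝ) × F)) [IsFiniteMeasure μ] :
    Continuous fun y : Dual ((Fin n → ℝ) × F) => _root_.charFun μ y := by
  refine continuous_of_dominated (bound := fun _ => 1) (fun y => ?_)
    (fun y => ae_of_all _ fun x => (Circle.norm_coe _).le) (integrable_const _)
    (ae_of_all _ fun x => ?_)
  · have h1 : Continuous fun x : (Fin n → ℝ) × F => y (Multiplicative.ofAdd x) :=
      (map_continuous y).comp continuous_ofAdd
    exact (continuous_subtype_val.comp h1).aestronglyMeasurable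
  · have h1 : Continuous fun y : Dual ((Fin n → ℝ) × F) => y (Multiplicative.ofAdd x) :=
      (ContinuousEvalConst.continuous_eval_const (F := C(Multiplicative ((Fin n → ℝ) × F), Circle))
        _).comp (ContinuousMonoidHom.isInducing_toContinuousMap
        (Multiplicative ((Fin n → ℝ) × F)) Circle).continuous
    exact continuous_subtype_val.comp h1

/-- The projection to `ℝⁿ` of a distribution satisfying the Gaussian functional equation is
Gaussian. -/
lemma isGaussian_map_fst (μ : Measure ((Fin n → ℝ) × F)) [IsProbabilityMeasure μ]
    (hne : ∀ s, pairingInt μ (s, 0) ≠ 0)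
    (heq : ∀ u v, pairingInt μ (u + v, 0) * pairingInt μ (u - v, 0) =
      pairingInt μ (u, 0) ^ 2 * (‖pairingInt μ (v, 0)‖ : ℂ) ^ 2) :
    _root_.IsGaussian (μ.map fun x => (x.1, (0 : F))) := by
  have hmeas : Measurable fun x : (Fin n → ℝ) × F => (x.1, (0 : F)) :=
    measurable_fst.prodMk measurable_const
  set γ := μ.map fun x => (x.1, (0 : F)) with hγ
  have : IsProbabilityMeasure γ := Measure.isProbabilityMeasure_map hmeas.aemeasurable
  have hchar : ∀ (y : Dual ((Fin n → ℝ) × F)) s,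
      (∀ x, y (Multiplicative.ofAdd (x, 0)) = Circle.exp (s ⬝ᵥ x)) →
      _root_.charFun γ y = pairingInt μ (s, 0) := by
    intro y s hs
    have h1 : Continuous fun x : (Fin n → ℝ) × F => (y (Multiplicative.ofAdd x) : ℂ) :=
      continuous_subtype_val.comp ((map_continuous y).comp continuous_ofAdd)
    rw [_root_.charFun, hγ, integral_map hmeas.aemeasurable h1.aestronglyMeasurable]
    simp [pairingInt, pairing, hs]
  have hcl := isCharLike_pairingInt μ
  set f : (Fin n → ℝ) → ℂ := fun s => pairingInt μ (s, 0) with hf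
  have hf0 : f 0 = 1 := hcl.map_zero
  have hfc : Continuous f := continuous_pairingInt μ
  have hnorm0 : ∀ s, (‖f s‖ : ℂ) ≠ 0 := fun s => by simpa using hne s
  have hnormeq : ∀ u v, ‖f (u + v)‖ * ‖f (u - v)‖ = ‖f u‖ ^ 2 * ‖f v‖ ^ 2 := by
    intro u v
    simpa using congrArg norm (heq u v)
  let ph : (Fin n → ℝ) → Circle := fun s =>
    ⟨f s / ‖f s‖, mem_sphere_zero_iff_norm.2 (by simp [hne s, hf])⟩
  have hphc : ∀ s, (ph s : ℂ) = f s / ‖f s‖ := fun _ => rfl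
  have hphsq : ∀ u v, ph (u + v) * ph (u - v) = ph u ^ 2 := by
    intro u v
    ext1
    have h1 := heq u v
    have h2 : (‖f (u + v)‖ : ℂ) * ‖f (u - v)‖ = (‖f u‖ : ℂ) ^ 2 * (‖f v‖ : ℂ) ^ 2 := by
      exact_mod_cast hnormeq u v
    simp only [Circle.coe_mul, Circle.coe_pow, hphc]
    rw [div_mul_div_comm, h2, div_pow, show f (u + v) * f (u - v) = _ from h1,
      mul_div_mul_right _ _ (pow_ne_zero 2 (hnorm0 v))]
  have hph0 : ph 0 = 1 := by
    ext1
    simp [ph, hf0]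
  have hphadd : ∀ x x', ph (x + x') = ph x * ph x' := by
    have hhalf : ∀ x, ph x = ph ((2 : ℝ)⁻¹ • x) ^ 2 := by
      intro x
      rw [← hphsq _ ((2 : ℝ)⁻¹ • x), sub_self, hph0, mul_one, ← add_smul]
      norm_num
    intro x x'
    rw [hhalf (x + x'), ← hphsq _ ((2 : ℝ)⁻¹ • (x - x'))]
    congr 2
    · module
    · module
  obtain ⟨a, ha⟩ := exists_exp_dotProduct ph
    (Continuous.subtype_mk (hfc.div (Complex.continuous_ofReal.comp hfc.norm) hnorm0) _) hphadd
  have hγne : ∀ y, ‖_root_.charFun γ y‖ ≠ 0 := by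
    intro y
    obtain ⟨s, hs⟩ := exists_dual_eq_exp y
    rw [hchar y s hs]
    exact norm_ne_zero_iff.2 (hne s)
  refine ⟨(a, 0), fun y => -Real.log ‖_root_.charFun γ y‖,
    ((continuous_charFun_dual γ).norm.log hγne).neg, fun y => ?_, fun y z => ?_, fun y => ?_⟩
  · obtain ⟨s, hs⟩ := exists_dual_eq_exp y
    beta_reduce
    rw [hchar y s hs]
    exact neg_nonneg.2 (Real.log_nonpos (norm_nonneg _) (hcl.norm_le _))
  · obtain ⟨s, hs⟩ := exists_dual_eq_exp y
    obtain ⟨t, ht⟩ := exists_dual_eq_exp z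
    beta_reduce
    rw [hchar y s hs, hchar z t ht,
      hchar (y * z) (s + t) fun x => by
        rw [add_dotProduct, Circle.exp_add, ← hs, ← ht]; rfl,
      hchar (y * z⁻¹) (s - t) fun x => by
        rw [sub_dotProduct, Circle.exp_sub, ← hs, ← ht, div_eq_mul_inv]; rfl]
    have h1 := congrArg Real.log (hnormeq s t)
    rw [Real.log_mul (norm_ne_zero_iff.2 (hne _)) (norm_ne_zero_iff.2 (hne _)),
      Real.log_mul (pow_ne_zero 2 (norm_ne_zero_iff.2 (hne _)))
        (pow_ne_zero 2 (norm_ne_zero_iff.2 (hne _))), Real.log_pow, Real.log_pow] at h1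
    push_cast at h1
    linarith
  · obtain ⟨s, hs⟩ := exists_dual_eq_exp y
    beta_reduce
    rw [hchar y s hs, hs, dotProduct_comm, ← ha, Complex.ofReal_neg, neg_neg,
      ← Complex.ofReal_exp, Real.exp_log (norm_pos_iff.2 (hne s)), hphc]
    exact (div_mul_cancel₀ _ (hnorm0 s)).symm

/-- The conclusion for `ξ` when `ξ + η` and `ξ + δη` are independent. -/
lemma exists_gaussian_conv_idempotent {Ω : Type*} [MeasurableSpace Ω] (P : Measure Ω)
    [IsProbabilityMeasure P] {ξ η : Ω → (Fin n → ℝ) × F} (hξ : Measurable ξ) (hη : Measurable η)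
    (hindep : IndepFun ξ η P) (δ : ((Fin n → ℝ) × F) ≃+ ((Fin n → ℝ) × F))
    (hδ : Continuous δ) (hδ' : Continuous δ.symm)
    (hL : IndepFun (fun ω => ξ ω + η ω) (fun ω => ξ ω + δ (η ω)) P) :
    ∃ γ ι : Measure ((Fin n → ℝ) × F), _root_.IsGaussian γ ∧ IsIdempotentDist ι ∧
      P.map ξ = γ.conv ι := by
  obtain ⟨εV, εH, hε⟩ := exists_adjoint δ hδ hδ'
  have hpair := isSkitovichPair_of_indepFun P hξ hη hindep δ hδ.measurable _ hε hL
  have := Measure.isProbabilityMeasure_map (μ := P) hξ.aemeasurable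
  have := Measure.isProbabilityMeasure_map (μ := P) hη.aemeasurable
  obtain ⟨hmod, hprod, hne, heq⟩ := hpair.left_structure εV εH (continuous_pairingInt _)
    (continuous_pairingInt _)
  set μ := P.map ξ with hμ
  have hm1 : Measurable fun x : (Fin n → ℝ) × F => (x.1, (0 : F)) :=
    measurable_fst.prodMk measurable_const
  have hm2 : Measurable fun x : (Fin n → ℝ) × F => ((0 : Fin n → ℝ), x.2) :=
    measurable_const.prodMk measurable_snd
  have := Measure.isProbabilityMeasure_map (μ := μ) hm1.aemeasurable
  have := Measure.isProbabilityMeasure_map (μ := μ) hm2.aemeasurable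
  have hι : ∀ s χ, pairingInt (μ.map fun x => ((0 : Fin n → ℝ), x.2)) (s, χ) =
      pairingInt μ (0, χ) := by
    intro s χ
    rw [pairingInt_map _ hm2]
    simp [pairingInt, pairing]
  have hγ : ∀ s χ, pairingInt (μ.map fun x => (x.1, (0 : F))) (s, χ) =
      pairingInt μ (s, 0) := by
    intro s χ
    rw [pairingInt_map _ hm1]
    simp [pairingInt, pairing]
  refine ⟨μ.map fun x => (x.1, 0), μ.map fun x => (0, x.2), isGaussian_map_fst μ hne heq,
    isIdempotentDist_of_norm _ ?_ ?_, ?_⟩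
  · exact (ae_map_iff hm2.aemeasurable (p := fun x => x.1 = 0)
      (measurable_fst (measurableSet_singleton 0))).2 (ae_of_all _ fun x => rfl)
  · intro χ
    rw [hι]
    exact hmod χ
  · have : IsFiniteMeasure ((μ.map fun x => (x.1, (0 : F))).conv
        (μ.map fun x => ((0 : Fin n → ℝ), x.2))) := by
      rw [Measure.conv]
      infer_instance
    refine ext_of_pairingInt fun p => ?_
    rw [pairingInt_conv, hγ, hι]
    exact hprod p.1 p.2

/-- The conclusion for the first variable of two independent linear forms. -/
lemma exists_gaussian_conv_idempotent_of_forms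
    (α₁ α₂ β₁ β₂ : ((Fin n → ℝ) × F) ≃+ ((Fin n → ℝ) × F))
    (hα₁ : Continuous α₁) (hα₁' : Continuous α₁.symm)
    (hα₂ : Continuous α₂) (hα₂' : Continuous α₂.symm)
    (hβ₁ : Continuous β₁) (hβ₁' : Continuous β₁.symm)
    (hβ₂ : Continuous β₂) (hβ₂' : Continuous β₂.symm)
    {Ω : Type*} [MeasurableSpace Ω] (P : Measure Ω) [IsProbabilityMeasure P]
    {ξ₁ ξ₂ : Ω → (Fin n → ℝ) × F} (hm₁ : Measurable ξ₁) (hm₂ : Measurable ξ₂)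
    (hindep : IndepFun ξ₁ ξ₂ P)
    (hL : IndepFun (fun ω => α₁ (ξ₁ ω) + α₂ (ξ₂ ω)) (fun ω => β₁ (ξ₁ ω) + β₂ (ξ₂ ω)) P) :
    ∃ γ ι : Measure ((Fin n → ℝ) × F), _root_.IsGaussian γ ∧ IsIdempotentDist ι ∧
      P.map ξ₁ = γ.conv ι := by
  have hκ : Measurable fun x => α₁.symm (α₂ x) := (hα₁'.comp hα₂).measurable
  refine exists_gaussian_conv_idempotent P (η := fun ω => α₁.symm (α₂ (ξ₂ ω))) hm₁
    (hκ.comp hm₂) (hindep.comp measurable_id hκ)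
    (((α₁.trans α₂.symm).trans β₂).trans β₁.symm) ?_ ?_ ?_
  · exact hβ₁'.comp (hβ₂.comp (hα₂'.comp hα₁))
  · exact hα₁'.comp (hα₂.comp (hβ₂'.comp hβ₁))
  · have h1 := hL.comp hα₁'.measurable hβ₁'.measurable
    simpa [Function.comp_def] using h1

end Structure

/-- Lemma 7: let `X = ℝⁿ × F` with `F` a finite Abelian group, and `α₁, α₂, β₁, β₂`
topological automorphisms of `X`. If the linear forms `L₁ = α₁ξ₁ + α₂ξ₂` and
`L₂ = β₁ξ₁ + β₂ξ₂` are independent, then `μⱼ ∈ Γ(X)*I(X)`, `j = 1, 2`. -/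
theorem heyde_lemma7 {n : ℕ} {F : Type*} [AddCommGroup F] [Fintype F]
    [TopologicalSpace F] [DiscreteTopology F] [MeasurableSpace F] [BorelSpace F]
    (α₁ α₂ β₁ β₂ : ((Fin n → ℝ) × F) ≃+ ((Fin n → ℝ) × F))
    (hα₁ : Continuous α₁) (hα₁' : Continuous α₁.symm)
    (hα₂ : Continuous α₂) (hα₂' : Continuous α₂.symm)
    (hβ₁ : Continuous β₁) (hβ₁' : Continuous β₁.symm)
    (hβ₂ : Continuous β₂) (hβ₂' : Continuous β₂.symm)
    {Ω : Type*} [MeasurableSpace Ω] (P : Measure Ω) [IsProbabilityMeasure P]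
    (ξ₁ ξ₂ : Ω → (Fin n → ℝ) × F) (hm₁ : Measurable ξ₁) (hm₂ : Measurable ξ₂)
    (hindep : IndepFun ξ₁ ξ₂ P)
    (hLindep : IndepFun (fun ω => α₁ (ξ₁ ω) + α₂ (ξ₂ ω))
      (fun ω => β₁ (ξ₁ ω) + β₂ (ξ₂ ω)) P) :
    (∃ γ ι : Measure ((Fin n → ℝ) × F), IsGaussian γ ∧ IsIdempotentDist ι ∧
      P.map ξ₁ = γ.conv ι) ∧
    (∃ γ ι : Measure ((Fin n → ℝ) × F), IsGaussian γ ∧ IsIdempotentDist ι ∧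
      P.map ξ₂ = γ.conv ι) := by
  exact ⟨exists_gaussian_conv_idempotent_of_forms α₁ α₂ β₁ β₂ hα₁ hα₁' hα₂ hα₂' hβ₁ hβ₁' hβ₂ hβ₂'
      P hm₁ hm₂ hindep hLindep,
    exists_gaussian_conv_idempotent_of_forms α₂ α₁ β₂ β₁ hα₂ hα₂' hα₁ hα₁' hβ₂ hβ₂' hβ₁ hβ₁'
      P hm₂ hm₁ hindep.symm (by simpa only [add_comm] using hLindep)⟩
end
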